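/- Let V = (I + 3X)/4, a 2×2 complex matrix, and let π_X = (I + X)/2. Then for every 2×2 complex matrix ρ: V ρ V† = −(1/8) ρ + (3/8) X ρ X + (3/4) π_X ρ π_X†. Moreover the coefficients sum to 1, i.e. −1/8 + 3/8 + 3/4 = 1, and the sum of their absolute values equals 5/4 (the sampling overhead γ = 5/4 of the decomposed effective HHL channel, Equation (26) of the paper). -/

import Mathlib

open Matrix
open scoped Matrix Kronecker

noncomputable section

/-- Kronecker product of square complex matrices, with the standard lexicographic
identification `Fin m × Fin n ≃ Fin (m * n)` (left factor most significant). -/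
def kron {m n : ℕ} (A : Matrix (Fin m) (Fin m) ℂ) (B : Matrix (Fin n) (Fin n) ℂ) :
    Matrix (Fin (m * n)) (Fin (m * n)) ℂ :=
  Matrix.reindex finProdFinEquiv finProdFinEquiv (A ⊗ₖ B)

/-- Transport a square matrix along an equality of dimensions. -/
def castM {a b : ℕ} (h : a = b) (A : Matrix (Fin a) (Fin a) ℂ) : Matrix (Fin b) (Fin b) ℂ :=
  Matrix.reindex (finCongr h) (finCongr h) A

theorem pow2mul {a b c : ℕ} (h : a + b = c) : 2 ^ a * 2 ^ b = 2 ^ c := by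
  rw [← pow_add, h]

def ket0bra0 : Matrix (Fin 2) (Fin 2) ℂ := !![1, 0; 0, 0]
def ket1bra1 : Matrix (Fin 2) (Fin 2) ℂ := !![0, 0; 0, 1]
def PauliX : Matrix (Fin 2) (Fin 2) ℂ := !![0, 1; 1, 0]
def PauliY : Matrix (Fin 2) (Fin 2) ℂ := !![0, -Complex.I; Complex.I, 0]
def PauliZ : Matrix (Fin 2) (Fin 2) ℂ := !![1, 0; 0, -1]

/-- `n`-fold Kronecker product of one-qubit matrices, `f 0` being the leftmost factor. -/
def kronPow : (k : ℕ) → (Fin k → Matrix (Fin 2) (Fin 2) ℂ) →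
    Matrix (Fin (2 ^ k)) (Fin (2 ^ k)) ℂ
  | 0, _ => 1
  | k + 1, f => castM (pow2mul (Nat.one_add k)) (kron (f 0) (kronPow k fun i => f i.succ))

/-- `(|0⟩⟨0|)^{⊗ k}`. -/
def projPow (k : ℕ) : Matrix (Fin (2 ^ k)) (Fin (2 ^ k)) ℂ := kronPow k fun _ => ket0bra0

/-- Diagonal projection with the first `r` diagonal entries equal to 1. -/
def diagProj (N r : ℕ) : Matrix (Fin N) (Fin N) ℂ :=
  Matrix.diagonal fun i => if (i : ℕ) < r then 1 else 0

/-- The sixteen Table-1 basis matrices (0-indexed). -/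
def tableV : Fin 16 → Matrix (Fin 2) (Fin 2) ℂ :=
  ![1, PauliX, PauliY, PauliZ,
    ((Real.sqrt 2 : ℝ) : ℂ)⁻¹ • (1 + Complex.I • PauliX),
    ((Real.sqrt 2 : ℝ) : ℂ)⁻¹ • (1 + Complex.I • PauliY),
    ((Real.sqrt 2 : ℝ) : ℂ)⁻¹ • (1 + Complex.I • PauliZ),
    ((Real.sqrt 2 : ℝ) : ℂ)⁻¹ • (PauliY + PauliZ),
    ((Real.sqrt 2 : ℝ) : ℂ)⁻¹ • (PauliZ + PauliX),
    ((Real.sqrt 2 : ℝ) : ℂ)⁻¹ • (PauliX + PauliY),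
    (2 : ℂ)⁻¹ • (1 + PauliX),
    (2 : ℂ)⁻¹ • (1 + PauliY),
    (2 : ℂ)⁻¹ • (1 + PauliZ),
    (2 : ℂ)⁻¹ • (PauliY + Complex.I • PauliZ),
    (2 : ℂ)⁻¹ • (PauliZ + Complex.I • PauliX),
    (2 : ℂ)⁻¹ • (PauliX + Complex.I • PauliY)]


def piX : Matrix (Fin 2) (Fin 2) ℂ := (2 : ℂ)⁻¹ • (1 + PauliX)

/-- The effective HHL matrix `V = (I + 3X)/4`. -/
def hhlV : Matrix (Fin 2) (Fin 2) ℂ := (4 : ℂ)⁻¹ • (1 + (3 : ℂ) • PauliX)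

theorem conjTranspose_PauliX : PauliXᴴ = PauliX := by
  ext i j
  fin_cases i <;> fin_cases j <;> simp [PauliX]

/-- the decomposition of the effective HHL channel (Equation (26)) with
sampling overhead `γ = 5/4`. -/
theorem stmt12 :
    (∀ ρ : Matrix (Fin 2) (Fin 2) ℂ,
      hhlV * ρ * hhlVᴴ
        = -(1/8 : ℂ) • ρ + (3/8 : ℂ) • (PauliX * ρ * PauliX) + (3/4 : ℂ) • (piX * ρ * piXᴴ))
    ∧ (-(1/8) + 3/8 + 3/4 : ℝ) = 1
    ∧ |(-(1/8) : ℝ)| + |(3/8 : ℝ)| + |(3/4 : ℝ)| = 5/4 := by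
  refine ⟨fun ρ => ?_, by norm_num, by norm_num [abs_of_pos]⟩
  rw [hhlV, piX]
  simp only [conjTranspose_smul, conjTranspose_add, conjTranspose_one, conjTranspose_PauliX,
    star_inv₀, star_ofNat, mul_add, add_mul, one_mul, mul_one, smul_mul_assoc, mul_smul_comm]
  module

end
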